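/- arXiv:1110.0366 — 2 statements merged into one kernel-verified Lean document; each statement's English description precedes it below -/
import Mathlib

section
/- Let f ∈ ℂ[x₁,…,xₙ] define a linear free divisor. Then 𝔤_D is a self-normalising Lie subalgebra of gl_n(ℂ): if B ∈ gl_n(ℂ) satisfies [B,C] ∈ 𝔤_D for every C ∈ 𝔤_D, then B ∈ 𝔤_D. -/
open MvPolynomial Matrix

/-- The linear vector field `δ_B` with coefficient matrix `B`: the unique `ℂ`-derivation of
`ℂ[x₁,…,xₙ]` with `δ_B(xᵢ) = ∑ⱼ Bᵢⱼ xⱼ`. -/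
noncomputable def deltaVF {n : ℕ} (B : Matrix (Fin n) (Fin n) ℂ) :
    Derivation ℂ (MvPolynomial (Fin n) ℂ) (MvPolynomial (Fin n) ℂ) :=
  ∑ i, (∑ j, B i j • (X j : MvPolynomial (Fin n) ℂ)) • pderiv i

/-- `𝔤_D = {B ∈ gl_n(ℂ) : δ_B(f) ∈ (f)}`. -/
def gD (n : ℕ) (f : MvPolynomial (Fin n) ℂ) : Set (Matrix (Fin n) (Fin n) ℂ) :=
  {B | deltaVF B f ∈ Ideal.span {f}}

/-- Saito's criterion: `f` defines a linear free divisor. -/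
def IsLinearFreeDivisor (n : ℕ) (f : MvPolynomial (Fin n) ℂ) : Prop :=
  ∃ Bs : Fin n → Matrix (Fin n) (Fin n) ℂ,
    (∀ k, Bs k ∈ gD n f) ∧
    ∃ c : ℂ, c ≠ 0 ∧
      (Matrix.of fun i k => ∑ j, (Bs k) i j • (X j : MvPolynomial (Fin n) ℂ)).det = c • f

/-- A squarefree element divides every element that all its prime divisors divide. -/
theorem Squarefree.dvd_of_forall_prime_dvd {R : Type*} [CommRing R] [IsDomain R]
    [UniqueFactorizationMonoid R] {a b : R} (ha : Squarefree a)
    (h : ∀ p, Prime p → p ∣ a → p ∣ b) : a ∣ b := by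
  classical
  let _ : StrongNormalizationMonoid R := UniqueFactorizationMonoid.strongNormalizationMonoid
  rcases eq_or_ne b 0 with rfl | hb
  · exact dvd_zero a
  have ha₀ : a ≠ 0 := ha.ne_zero
  rw [UniqueFactorizationMonoid.dvd_iff_normalizedFactors_le_normalizedFactors ha₀ hb,
    Multiset.le_iff_subset
      ((UniqueFactorizationMonoid.squarefree_iff_nodup_normalizedFactors ha₀).1 ha)]
  intro p hp
  rw [UniqueFactorizationMonoid.mem_normalizedFactors_iff' ha₀] at hp
  rw [UniqueFactorizationMonoid.mem_normalizedFactors_iff' hb]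
  exact ⟨hp.1, hp.2.1, h p hp.1.prime hp.2.2⟩

namespace MvPolynomial

variable {σ K : Type*} [Field K]

theorem eq_C_of_forall_pderiv_eq_zero [CharZero K] {p : MvPolynomial σ K} (h : ∀ i, pderiv i p = 0) :
    p = C (p.coeff 0) := by
  classical
  ext d
  rw [coeff_C]
  split_ifs with hd
  · rw [hd]
  · obtain ⟨i, hi⟩ : ∃ i, d i ≠ 0 := by
      by_contra! hc
      exact hd (Finsupp.ext fun i => (hc i).symm)
    have hcoeff := coeff_pderiv (i := i) p (d - Finsupp.single i 1)
    rw [h i, coeff_zero, tsub_add_cancel_of_le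
      (Finsupp.single_le_iff.2 (Nat.one_le_iff_ne_zero.2 hi))] at hcoeff
    exact (mul_eq_zero.1 hcoeff.symm).resolve_right (Nat.cast_add_one_ne_zero _)

theorem pderiv_eq_zero_of_dvd {p : MvPolynomial σ K} {i : σ} (h : p ∣ pderiv i p) :
    pderiv i p = 0 := by
  by_contra h₀
  have hle := totalDegree_le_of_dvd_of_isDomain h h₀
  obtain ⟨m, hm, hdeg⟩ := Finset.exists_mem_eq_sup (pderiv i p).support
    (support_nonempty.2 h₀) fun s => s.sum fun _ e => e
  have hmem : m + Finsupp.single i 1 ∈ p.support := by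
    rw [mem_support_iff] at hm ⊢
    intro hc
    exact hm (by rw [coeff_pderiv, hc, zero_mul])
  have hlt := le_totalDegree hmem
  rw [Finsupp.sum_add_index' (fun _ => rfl) (fun _ _ _ => rfl),
    Finsupp.sum_single_index rfl] at hlt
  change (pderiv i p).totalDegree = _ at hdeg
  omega

theorem _root_.Prime.exists_not_dvd_pderiv [CharZero K] {p : MvPolynomial σ K} (hp : Prime p) :
    ∃ i, ¬ p ∣ pderiv i p := by
  by_contra! h
  have hC := eq_C_of_forall_pderiv_eq_zero fun i => pderiv_eq_zero_of_dvd (h i)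
  refine hp.not_isUnit ?_
  rw [hC]
  refine (isUnit_iff_ne_zero.2 fun h₀ => hp.ne_zero ?_).map C
  rw [hC, h₀, C_0]

/-- If a squarefree polynomial divides all products of `d` with its partial derivatives, then it
divides `d`. -/
theorem _root_.Squarefree.dvd_of_forall_dvd_mul_pderiv [CharZero K] {f d : MvPolynomial σ K}
    (hf : Squarefree f) (h : ∀ i, f ∣ d * pderiv i f) : f ∣ d := by
  refine hf.dvd_of_forall_prime_dvd fun p hp ⟨g, hg⟩ => ?_
  obtain ⟨i, hi⟩ := hp.exists_not_dvd_pderiv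
  have hpg : ¬ p ∣ g := fun ⟨r, hr⟩ =>
    hp.not_isUnit (hf p ⟨r, by rw [hg, hr, mul_assoc]⟩)
  have hdvd : p ∣ d * pderiv i f := (Dvd.intro _ hg.symm).trans (h i)
  refine (hp.dvd_or_dvd hdvd).resolve_right fun hpd => ?_
  rw [hg, pderiv_mul, dvd_add_left (dvd_mul_right _ _)] at hpd
  exact (hp.dvd_or_dvd hpd).elim hi hpg

/-- The determinant of vector fields logarithmic along a squarefree `f` is divisible by `f`. -/
theorem _root_.Squarefree.dvd_det_of_forall_dvd [CharZero K] [Fintype σ] [DecidableEq σ]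
    {f : MvPolynomial σ K} (hf : Squarefree f) (N : Matrix σ σ (MvPolynomial σ K))
    (h : ∀ k, f ∣ ∑ i, N i k * pderiv i f) : f ∣ N.det := by
  refine hf.dvd_of_forall_dvd_mul_pderiv fun i => ?_
  have key : ((fun j => pderiv j f) ᵥ* N ᵥ* N.adjugate) i = N.det * pderiv i f := by
    rw [vecMul_vecMul, mul_adjugate, vecMul_smul, vecMul_one]
    rfl
  rw [← key]
  refine Finset.dvd_sum fun k _ => Dvd.dvd.mul_right ?_ _
  simpa only [vecMul, dotProduct, mul_comm] using h k

end MvPolynomial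

namespace Derivation

variable {R A ι : Type*} [CommRing R] [CommRing A] [Algebra R A] [DecidableEq ι]

theorem leibniz_finset_prod (D : Derivation R A A) (s : Finset ι) (g : ι → A) :
    D (∏ i ∈ s, g i) = ∑ i ∈ s, (∏ j ∈ s.erase i, g j) * D (g i) := by
  induction s using Finset.induction_on with
  | empty => simp
  | insert a s ha ih =>
    rw [Finset.prod_insert ha, D.leibniz, ih, Finset.sum_insert ha, Finset.erase_insert ha,
      smul_eq_mul, smul_eq_mul, Finset.mul_sum, add_comm]
    refine congrArg _ (Finset.sum_congr rfl fun i hi => ?_)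
    rw [Finset.erase_insert_of_ne (ne_of_mem_of_not_mem hi ha).symm,
      Finset.prod_insert (fun h => ha (Finset.mem_of_mem_erase h)), mul_assoc]

/-- A derivation acts on a determinant column by column. -/
theorem map_det [Fintype ι] (D : Derivation R A A) (M : Matrix ι ι A) :
    D M.det = ∑ k, (M.updateCol k fun i => D (M i k)).det := by
  simp only [det_apply, map_sum]
  rw [Finset.sum_comm]
  refine Finset.sum_congr rfl fun τ _ => ?_
  rw [← Finset.smul_sum]
  have hsmul : D (Equiv.Perm.sign τ • ∏ i, M (τ i) i) =
      Equiv.Perm.sign τ • D (∏ i, M (τ i) i) := by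
    rcases Int.units_eq_one_or (Equiv.Perm.sign τ) with h | h <;> simp [h]
  rw [hsmul, leibniz_finset_prod]
  refine congrArg _ (Finset.sum_congr rfl fun k _ => ?_)
  rw [← Finset.prod_erase_mul _ _ (Finset.mem_univ k), updateCol_self]
  refine congrArg (· * _) (Finset.prod_congr rfl fun j hj => ?_)
  rw [updateCol_ne (Finset.ne_of_mem_erase hj)]

end Derivation

/-- Replacing each column in turn by its image under `A` multiplies the determinant by the trace
of `A`. -/
theorem Matrix.sum_det_updateCol_mul {ι A : Type*} [Fintype ι] [DecidableEq ι] [CommRing A]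
    (P M : Matrix ι ι A) :
    ∑ k, (M.updateCol k fun i => (P * M) i k).det = P.trace * M.det := by
  have h : ∀ k, (M.updateCol k fun i => (P * M) i k).det = (M.adjugate * (P * M)) k k := by
    intro k
    rw [← cramer_apply, cramer_eq_adjugate_mulVec]
    rfl
  simp only [h]
  change (M.adjugate * (P * M)).trace = _
  rw [trace_mul_comm, Matrix.mul_assoc, mul_adjugate, Matrix.mul_smul, Matrix.mul_one, trace_smul,
    smul_eq_mul, mul_comm]

/-- The coefficients of the linear vector field `δ_B`. -/
noncomputable def linearCoeffs {n : ℕ} (B : Matrix (Fin n) (Fin n) ℂ) (i : Fin n) :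
    MvPolynomial (Fin n) ℂ :=
  ∑ j, B i j • X j

theorem linearCoeffs_eq_mulVec {n : ℕ} (B : Matrix (Fin n) (Fin n) ℂ) :
    linearCoeffs B = B.map C *ᵥ X := by
  ext1 i
  simp [linearCoeffs, mulVec, dotProduct, smul_eq_C_mul]

theorem deltaVF_apply {n : ℕ} (B : Matrix (Fin n) (Fin n) ℂ) (g : MvPolynomial (Fin n) ℂ) :
    deltaVF B g = ∑ i, linearCoeffs B i * pderiv i g := by
  rw [deltaVF, ← Derivation.coeFnAddMonoidHom_apply, map_sum, Finset.sum_apply]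
  rfl

theorem mem_gD_iff {n : ℕ} {f : MvPolynomial (Fin n) ℂ} {B : Matrix (Fin n) (Fin n) ℂ} :
    B ∈ gD n f ↔ f ∣ ∑ i, linearCoeffs B i * pderiv i f := by
  rw [gD, Set.mem_ofPred_eq, Ideal.mem_span_singleton, deltaVF_apply]

theorem deltaVF_X {n : ℕ} (B : Matrix (Fin n) (Fin n) ℂ) (j : Fin n) :
    deltaVF B (X j) = linearCoeffs B j := by
  simp [deltaVF_apply, pderiv_X, Pi.single_apply]

theorem deltaVF_linearCoeffs {n : ℕ} (B A : Matrix (Fin n) (Fin n) ℂ) (i : Fin n) :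
    deltaVF B (linearCoeffs A i) = linearCoeffs (A * B) i := by
  have h : deltaVF B (linearCoeffs A i) = (A.map C *ᵥ linearCoeffs B) i := by
    simp [linearCoeffs, deltaVF_X, mulVec, dotProduct, smul_eq_C_mul]
  rw [h, linearCoeffs_eq_mulVec, linearCoeffs_eq_mulVec, mulVec_mulVec, Matrix.map_mul]

theorem deltaVF_linearCoeffs_eq_sub {n : ℕ} (B A : Matrix (Fin n) (Fin n) ℂ) (i : Fin n) :
    deltaVF B (linearCoeffs A i) =
      (B.map C *ᵥ linearCoeffs A) i - linearCoeffs ⁅B, A⁆ i := by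
  have h : A * B = B * A - ⁅B, A⁆ := by rw [Ring.lie_def]; abel
  rw [deltaVF_linearCoeffs, h, linearCoeffs_eq_mulVec A, mulVec_mulVec, ← Matrix.map_mul,
    ← linearCoeffs_eq_mulVec]
  simp [linearCoeffs, sub_smul]

/-- `𝔤_D` is a self-normalising Lie subalgebra of `gl_n(ℂ)`. -/
theorem gD_self_normalising
    (n : ℕ) (f : MvPolynomial (Fin n) ℂ)
    (hsq : Squarefree f) (hhom : f.IsHomogeneous n)
    (hlfd : IsLinearFreeDivisor n f)
    (B : Matrix (Fin n) (Fin n) ℂ)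
    (hB : ∀ C ∈ gD n f, ⁅B, C⁆ ∈ gD n f) :
    B ∈ gD n f := by
  obtain ⟨Bs, hBs, c, hc, hdet⟩ := hlfd
  let M : Matrix (Fin n) (Fin n) (MvPolynomial (Fin n) ℂ) :=
    Matrix.of fun i k => linearCoeffs (Bs k) i
  let P : Matrix (Fin n) (Fin n) (MvPolynomial (Fin n) ℂ) := B.map C
  replace hdet : M.det = c • f := hdet
  have hfdet : f ∣ M.det := by
    rw [hdet, smul_eq_C_mul]
    exact dvd_mul_left _ _
  have hcol : ∀ k, (M.updateCol k fun i => deltaVF B (M i k)).det =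
      (M.updateCol k fun i => (P * M) i k).det -
        (M.updateCol k (linearCoeffs ⁅B, Bs k⁆)).det := by
    intro k
    have h : (fun i => deltaVF B (M i k)) =
        (fun i => (P * M) i k) - linearCoeffs ⁅B, Bs k⁆ :=
      funext fun i => deltaVF_linearCoeffs_eq_sub B (Bs k) i
    rw [h, ← cramer_apply, map_sub, Pi.sub_apply, cramer_apply, cramer_apply]
  have hlog : ∀ k, f ∣ (M.updateCol k (linearCoeffs ⁅B, Bs k⁆)).det := by
    refine fun k => hsq.dvd_det_of_forall_dvd _ fun l => ?_
    rcases eq_or_ne l k with rfl | hl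
    · simpa only [updateCol_self] using mem_gD_iff.1 (hB _ (hBs l))
    · simp only [updateCol_ne hl]
      exact mem_gD_iff.1 (hBs l)
  have hD : f ∣ deltaVF B M.det := by
    rw [Derivation.map_det]
    simp only [hcol]
    rw [Finset.sum_sub_distrib, sum_det_updateCol_mul]
    exact dvd_sub (hfdet.mul_left _) (Finset.dvd_sum fun k _ => hlog k)
  rw [hdet, Derivation.map_smul, smul_eq_C_mul] at hD
  rw [gD, Set.mem_ofPred_eq, Ideal.mem_span_singleton]
  exact ((isUnit_iff_ne_zero.2 hc).map C).dvd_mul_left.1 hD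
end

section
/- Let f ∈ ℂ[x,y] be squarefree and homogeneous of degree k ≥ 3, with partial derivatives f_x = ∂f/∂x and f_y = ∂f/∂y. Then the four polynomials x·f_x, x·f_y, y·f_x, y·f_y are linearly independent over ℂ. -/
open MvPolynomial

namespace MvPolynomial

variable {σ R : Type*} [CommRing R]

theorem degreeOf_pderiv_lt {p : MvPolynomial σ R} {i : σ} (h : 0 < p.degreeOf i) :
    (pderiv i p).degreeOf i < p.degreeOf i := by
  rw [degreeOf_lt_iff h]
  intro m hm
  rw [mem_support_iff, coeff_pderiv] at hm
  have := monomial_le_degreeOf i (mem_support_iff.mpr (left_ne_zero_of_mul hm))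
  simpa using this

theorem pderiv_ne_zero [IsDomain R] [CharZero R] {p : MvPolynomial σ R} {i : σ} (h : 0 < p.degreeOf i) :
    pderiv i p ≠ 0 := by
  classical
  intro h0
  refine h.ne' (Nat.le_zero.mp ?_)
  rw [degreeOf_le_iff]
  intro m hm
  by_contra! hlt
  have hle : Finsupp.single i 1 ≤ m := Finsupp.single_le_iff.mpr hlt
  have hc := congrArg (coeff (m - Finsupp.single i 1)) h0
  rw [coeff_pderiv, tsub_add_cancel_of_le hle, coeff_zero] at hc
  exact mul_ne_zero (mem_support_iff.mp hm) (Nat.cast_add_one_ne_zero _) hc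

theorem degreeOf_eq_zero_of_dvd_pderiv [IsDomain R] [CharZero R] {p : MvPolynomial σ R} {i : σ} (h : p ∣ pderiv i p) :
    p.degreeOf i = 0 := by
  by_contra hd
  have hpos := Nat.pos_of_ne_zero hd
  obtain ⟨q, hq⟩ := h
  have hne := pderiv_ne_zero hpos
  rw [hq] at hne
  have hlt := degreeOf_pderiv_lt hpos
  rw [hq, degreeOf_mul_eq (left_ne_zero_of_mul hne) (right_ne_zero_of_mul hne)] at hlt
  lia

theorem isUnit_of_forall_dvd_pderiv {K : Type*} [Field K] [CharZero K] {p : MvPolynomial σ K}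
    (hp : p ≠ 0) (h : ∀ i, p ∣ pderiv i p) : IsUnit p := by
  have hdeg : p.totalDegree = 0 := by
    rw [totalDegree_eq_zero_iff]
    intro m hm i
    have := monomial_le_degreeOf i hm
    rw [degreeOf_eq_zero_of_dvd_pderiv (h i)] at this
    exact Nat.le_zero.mp this
  rw [totalDegree_eq_zero_iff_eq_C] at hdeg
  rw [hdeg] at hp ⊢
  exact (IsUnit.mk0 _ (by simpa using hp)).map C

/-- The first partial derivatives of a squarefree homogeneous polynomial of positive degree
have no common irreducible factor. -/
theorem IsHomogeneous.not_forall_dvd_pderiv {K : Type*} [Field K] [CharZero K] [Fintype σ]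
    {f : MvPolynomial σ K} {n : ℕ} (hf : f.IsHomogeneous n) (hn : n ≠ 0) (hsq : Squarefree f)
    {p : MvPolynomial σ K} (hp : Irreducible p) : ¬ ∀ i, p ∣ pderiv i f := by
  intro h
  have hpf : p ∣ f := by
    have hdvd : p ∣ n • f := by
      rw [← hf.sum_X_mul_pderiv]
      exact Finset.dvd_sum fun i _ ↦ (h i).mul_left _
    have hu : IsUnit (n : MvPolynomial σ K) := by
      simpa using (IsUnit.mk0 (n : K) (Nat.cast_ne_zero.mpr hn)).map (C (σ := σ))
    rwa [nsmul_eq_mul, hu.dvd_mul_left] at hdvd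
  obtain ⟨g, rfl⟩ := hpf
  have hpg : ¬ p ∣ g := fun hg ↦ hp.not_isUnit (hsq p (mul_dvd_mul_left p hg))
  refine hp.not_isUnit (isUnit_of_forall_dvd_pderiv hp.ne_zero fun i ↦ ?_)
  have hi := h i
  rw [pderiv_mul, dvd_add_left (dvd_mul_right _ _)] at hi
  exact (hp.prime.dvd_or_dvd hi).resolve_right hpg

theorem IsHomogeneous.isRelPrime_pderiv {K : Type*} [Field K] [CharZero K]
    {f : MvPolynomial (Fin 2) K} {n : ℕ} (hf : f.IsHomogeneous n) (hn : n ≠ 0)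
    (hsq : Squarefree f) : IsRelPrime (pderiv 0 f) (pderiv 1 f) := by
  have key {p : MvPolynomial (Fin 2) K} (hp : Irreducible p) (h0 : p ∣ pderiv 0 f)
      (h1 : p ∣ pderiv 1 f) : False :=
    hf.not_forall_dvd_pderiv hn hsq hp (Fin.forall_fin_two.mpr ⟨h0, h1⟩)
  refine isRelPrime_of_no_nonunits_factors ?_ fun z hz hz0 h0 h1 ↦ ?_
  · rintro ⟨h0, h1⟩
    exact key (X_prime (i := 0)).irreducible (h0 ▸ dvd_zero _) (h1 ▸ dvd_zero _)
  · obtain ⟨p, hp, hpz⟩ := WfDvdMonoid.exists_irreducible_factor hz hz0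
    exact key hp (hpz.trans h0) (hpz.trans h1)

theorem IsHomogeneous.eq_zero_of_dvd [IsDomain R] {p q : MvPolynomial σ R} {m n : ℕ}
    (hp : p.IsHomogeneous m) (hq : q.IsHomogeneous n) (hnm : n < m) (h : p ∣ q) : q = 0 := by
  by_contra hq0
  have hp0 : p ≠ 0 := fun hp0 ↦ hq0 (zero_dvd_iff.mp (hp0 ▸ h))
  have hle := totalDegree_le_of_dvd_of_isDomain h hq0
  rw [hp.totalDegree hp0, hq.totalDegree hq0] at hle
  lia

theorem isHomogeneous_C_mul_X_add_C_mul_X (a b : R) (i j : σ) :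
    (C a * X i + C b * X j).IsHomogeneous 1 :=
  (isHomogeneous_C_mul_X a i).add (isHomogeneous_C_mul_X b j)

theorem eq_zero_of_C_mul_X_add_C_mul_X_eq_zero {a b : R}
    (h : C a * X 0 + C b * X 1 = (0 : MvPolynomial (Fin 2) R)) : a = 0 ∧ b = 0 := by
  constructor
  · simpa using congrArg (eval ![1, 0]) h
  · simpa using congrArg (eval ![0, 1]) h

end MvPolynomial

/-- For a squarefree homogeneous `f ∈ ℂ[x,y]` of degree `k ≥ 3`, the polynomials
`x·f_x, x·f_y, y·f_x, y·f_y` are linearly independent over `ℂ`. -/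
theorem linearIndependent_x_y_mul_partials
    (k : ℕ) (hk : 3 ≤ k) (f : MvPolynomial (Fin 2) ℂ)
    (hsq : Squarefree f) (hhom : f.IsHomogeneous k) :
    LinearIndependent ℂ
      ![X 0 * pderiv 0 f, X 0 * pderiv 1 f, X 1 * pderiv 0 f, X 1 * pderiv 1 f] := by
  rw [Fintype.linearIndependent_iff]
  intro g hg
  have hrel : (C (g 0) * X 0 + C (g 2) * X 1) * pderiv 0 f +
      (C (g 1) * X 0 + C (g 3) * X 1) * pderiv 1 f = 0 := by
    simp only [Fin.sum_univ_four, smul_eq_C_mul, Matrix.cons_val] at hg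
    linear_combination hg
  have hprime := hhom.isRelPrime_pderiv (by lia) hsq
  have hdvd₁ : pderiv 1 f ∣ C (g 0) * X 0 + C (g 2) * X 1 := by
    refine hprime.symm.dvd_of_dvd_mul_right ?_
    rw [eq_neg_of_add_eq_zero_left hrel, dvd_neg]
    exact dvd_mul_left _ _
  have hdvd₀ : pderiv 0 f ∣ C (g 1) * X 0 + C (g 3) * X 1 := by
    refine hprime.dvd_of_dvd_mul_right ?_
    rw [eq_neg_of_add_eq_zero_right hrel, dvd_neg]
    exact dvd_mul_left _ _
  have hL := hhom.pderiv.eq_zero_of_dvd (isHomogeneous_C_mul_X_add_C_mul_X _ _ _ _)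
    (by lia) hdvd₁
  have hM := hhom.pderiv.eq_zero_of_dvd (isHomogeneous_C_mul_X_add_C_mul_X _ _ _ _)
    (by lia) hdvd₀
  obtain ⟨h0, h2⟩ := eq_zero_of_C_mul_X_add_C_mul_X_eq_zero hL
  obtain ⟨h1, h3⟩ := eq_zero_of_C_mul_X_add_C_mul_X_eq_zero hM
  intro i
  fin_cases i <;> assumption
end
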